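/- For all s, t ∈ ℝ³, let T = (‖s‖² − ‖t‖²) + 2·i·(s·t) ∈ ℂ. Then |Im √T| ≤ 2·‖t‖, where √ is the principal branch of the complex square root. -/

import Mathlib

open scoped RealInnerProductSpace

/-- Principal branch of the complex square root. -/
noncomputable def csqrt (z : ℂ) : ℂ := z ^ (1/2 : ℂ)

theorem csqrt_sq (z : ℂ) : csqrt z ^ 2 = z := by
  simp [csqrt]

/-- A complex number `w` with `w ^ 2 = (‖s‖² − ‖t‖²) + 2i ⟪s, t⟫` satisfies `|Im w| ≤ ‖t‖`. -/
theorem abs_im_le_norm_of_sq_eq {E : Type*} [NormedAddCommGroup E] [InnerProductSpace ℝ E]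
    {s t : E} {w : ℂ}
    (hw : w ^ 2 = ((‖s‖ ^ 2 - ‖t‖ ^ 2 : ℝ) : ℂ) + 2 * Complex.I * ((⟪s, t⟫ : ℝ) : ℂ)) :
    |w.im| ≤ ‖t‖ := by
  have hre : w.re * w.re - w.im * w.im = ‖s‖ ^ 2 - ‖t‖ ^ 2 := by
    have h := congrArg Complex.re hw
    rw [pow_two, Complex.mul_re, Complex.add_re, Complex.ofReal_re] at h
    simpa using h
  have him : w.re * w.im = ⟪s, t⟫ := by
    have h := congrArg Complex.im hw
    rw [pow_two, Complex.mul_im, Complex.add_im, Complex.ofReal_im] at h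
    simp at h
    linarith
  have hcs : (w.re * w.im) ^ 2 ≤ ‖s‖ ^ 2 * ‖t‖ ^ 2 := by
    rw [him, ← mul_pow]
    exact sq_le_sq' (neg_le_of_abs_le (abs_real_inner_le_norm s t)) (real_inner_le_norm s t)
  refine abs_le_of_sq_le_sq (not_lt.1 fun hlt => ?_) (norm_nonneg t)
  have hpos : 0 < (w.im ^ 2 - ‖t‖ ^ 2) * (w.im ^ 2 + ‖s‖ ^ 2) :=
    mul_pos (sub_pos.2 hlt) (by nlinarith [sq_nonneg ‖s‖, sq_nonneg ‖t‖])
  have hre' : w.re ^ 2 = ‖s‖ ^ 2 - ‖t‖ ^ 2 + w.im ^ 2 := by linarith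
  rw [mul_pow, hre'] at hcs
  linarith

/-- for `s, t ∈ ℝ³` and `T = (‖s‖² − ‖t‖²) + 2i (s·t)`,
one has `|Im √T| ≤ 2 ‖t‖`. -/
theorem stmt12 (s t : EuclideanSpace ℝ (Fin 3)) (T : ℂ)
    (hT : T = ((‖s‖ ^ 2 - ‖t‖ ^ 2 : ℝ) : ℂ) + 2 * Complex.I * ((⟪s, t⟫ : ℝ) : ℂ)) :
    |(csqrt T).im| ≤ 2 * ‖t‖ := by
  have h : |(csqrt T).im| ≤ ‖t‖ := abs_im_le_norm_of_sq_eq ((csqrt_sq T).trans hT)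
  linarith [norm_nonneg t]
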